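/- Let p ≥ 1 and let K ⊂ ℝⁿ be a centrally symmetric convex body of volume 1 which is p-convex with constant α > 0, with Euclidean diameter d_K. Let f : ℝⁿ → ℝ be 1-Lipschitz with respect to the Euclidean metric, and let Med(f) be a median of f on K, i.e. a value such that both {x ∈ K : f(x) ≥ Med(f)} and {x ∈ K : f(x) ≤ Med(f)} have Lebesgue measure at least 1/2. Then for every t > 0, the Lebesgue measure of {x ∈ K : f(x) ≥ Med(f) + t} is at most 2·exp(−2αn(t/d_K)^p). -/

import Mathlib

open MeasureTheory
open scoped RealInnerProductSpace ENNReal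

noncomputable section

/-- A centrally symmetric convex body: compact, convex, with nonempty interior,
and symmetric about the origin. -/
def IsSymmConvexBody {E : Type*} [NormedAddCommGroup E] [NormedSpace ℝ E]
    (K : Set E) : Prop :=
  IsCompact K ∧ Convex ℝ K ∧ (interior K).Nonempty ∧ K = -K

/-- The modulus of convexity of `K`, defined via the gauge (Minkowski functional) of `K`. -/
def modulusOfConvexity {E : Type*} [AddCommGroup E] [Module ℝ E]
    (K : Set E) (ε : ℝ) : ℝ :=
  sInf { d | ∃ x y : E, gauge K x ≤ 1 ∧ gauge K y ≤ 1 ∧ ε ≤ gauge K (x - y) ∧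
    d = 1 - gauge K ((2:ℝ)⁻¹ • (x + y)) }

/-- `K` is 2-convex with constant `α`: `δ_K(ε) ≥ α ε²` for all `0 < ε ≤ 2`. -/
def IsTwoConvex {E : Type*} [AddCommGroup E] [Module ℝ E]
    (K : Set E) (α : ℝ) : Prop :=
  ∀ ε : ℝ, 0 < ε → ε ≤ 2 → α * ε ^ 2 ≤ modulusOfConvexity K ε

/-- `K` is `p`-convex with constant `α`: `δ_K(ε) ≥ α ε^p` for all `0 < ε ≤ 2`. -/
def IsPConvex {E : Type*} [AddCommGroup E] [Module ℝ E]
    (K : Set E) (p α : ℝ) : Prop :=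
  ∀ ε : ℝ, 0 < ε → ε ≤ 2 → α * ε ^ p ≤ modulusOfConvexity K ε

section BrunnMinkowski

open scoped Pointwise

/-- The set of midpoints of a point of `A` and a point of `B`. -/
def midpointSet {E : Type*} [AddCommGroup E] [Module ℝ E] (A B : Set E) : Set E :=
  (fun z : E × E => (2⁻¹ : ℝ) • (z.1 + z.2)) '' (A ×ˢ B)

theorem smul_add_mem_midpointSet {E : Type*} [AddCommGroup E] [Module ℝ E] {A B : Set E} {x y : E}
    (hx : x ∈ A) (hy : y ∈ B) : (2⁻¹ : ℝ) • (x + y) ∈ midpointSet A B :=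
  ⟨(x, y), ⟨hx, hy⟩, rfl⟩

theorem IsCompact.midpointSet {E : Type*} [AddCommGroup E] [Module ℝ E] [TopologicalSpace E]
    [ContinuousAdd E] [ContinuousConstSMul ℝ E] {A B : Set E}
    (hA : IsCompact A) (hB : IsCompact B) : IsCompact (midpointSet A B) :=
  (hA.prod hB).image (by fun_prop)

theorem midpointSet_image {E F : Type*} [AddCommGroup E] [Module ℝ E] [AddCommGroup F]
    [Module ℝ F] (L : E →ₗ[ℝ] F) (A B : Set E) :
    midpointSet (L '' A) (L '' B) = L '' midpointSet A B := by
  ext z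
  constructor
  · rintro ⟨⟨_, _⟩, ⟨⟨a, ha, rfl⟩, b, hb, rfl⟩, rfl⟩
    exact ⟨_, smul_add_mem_midpointSet ha hb, by simp⟩
  · rintro ⟨_, ⟨⟨a, b⟩, ⟨ha, hb⟩, rfl⟩, rfl⟩
    exact ⟨(L a, L b), ⟨⟨a, ha, rfl⟩, b, hb, rfl⟩, by simp⟩

/-- The multiplicative Brunn–Minkowski inequality at the midpoint, for compact sets. -/
def MidpointBrunnMinkowski {E : Type*} [AddCommGroup E] [Module ℝ E] [TopologicalSpace E]
    [MeasurableSpace E] (μ : Measure E) : Prop :=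
  ∀ A B : Set E, IsCompact A → IsCompact B → μ A * μ B ≤ μ (midpointSet A B) ^ 2

theorem MidpointBrunnMinkowski.of_measurePreserving {E F : Type*}
    [AddCommGroup E] [Module ℝ E] [TopologicalSpace E] [MeasurableSpace E]
    [IsTopologicalAddGroup E] [ContinuousConstSMul ℝ E]
    [AddCommGroup F] [Module ℝ F] [TopologicalSpace F] [MeasurableSpace F] [T2Space F]
    [BorelSpace F] {μ : Measure E} {ν : Measure F} (hν : MidpointBrunnMinkowski ν)
    (L : E →ₗ[ℝ] F) (hc : Continuous L) (hinj : Function.Injective L)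
    (hL : MeasurePreserving L μ ν) : MidpointBrunnMinkowski μ := by
  have key : ∀ A : Set E, IsCompact A → ν (L '' A) = μ A := fun A hA => by
    rw [← hL.measure_preimage (hA.image hc).measurableSet.nullMeasurableSet,
      Set.preimage_image_eq _ hinj]
  intro A B hA hB
  have := hν _ _ (hA.image hc) (hB.image hc)
  rwa [midpointSet_image, key A hA, key B hB, key _ (hA.midpointSet hB)] at this

theorem volume_add_volume_le_two_mul_volume_midpointSet_of_isCompact {A B : Set ℝ}
    (hA : IsCompact A) (hB : IsCompact B) (hA' : A.Nonempty) (hB' : B.Nonempty) :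
    volume A + volume B ≤ 2 * volume (midpointSet A B) := by
  obtain ⟨a, ha⟩ := hA.exists_isGreatest hA'
  obtain ⟨b, hb⟩ := hB.exists_isLeast hB'
  have h2 : volume (A + B) = 2 * volume (midpointSet A B) := by
    have : midpointSet A B = (2⁻¹ : ℝ) • (A + B) := by
      ext z
      simp only [midpointSet, Set.mem_image, Set.mem_prod, Prod.exists, Set.mem_smul_set,
        Set.mem_add]
      constructor
      · rintro ⟨x, y, ⟨hx, hy⟩, rfl⟩
        exact ⟨_, ⟨x, hx, y, hy, rfl⟩, rfl⟩
      · rintro ⟨_, ⟨x, hx, y, hy, rfl⟩, rfl⟩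
        exact ⟨x, y, ⟨hx, hy⟩, rfl⟩
    rw [this, Measure.addHaar_smul]
    rw [Module.finrank_self, pow_one]
    rw [← mul_assoc, abs_of_pos (by norm_num), ENNReal.ofReal_inv_of_pos two_pos,
      ENNReal.ofReal_ofNat, ENNReal.mul_inv_cancel two_ne_zero ENNReal.ofNat_ne_top, one_mul]
  rw [← h2]
  calc volume A + volume B = volume ((· + b) '' A) + volume ((a + ·) '' B) := by
        simp [Set.image_add_right, Set.image_add_left]
    _ = volume ((· + b) '' A ∪ (a + ·) '' B) := by
        refine (measure_union₀ (hB.image (by fun_prop)).measurableSet.nullMeasurableSet ?_).symm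
        refine measure_mono_null (t := {a + b}) ?_ (by simp)
        rintro _ ⟨⟨x, hx, rfl⟩, y, hy, hxy⟩
        have h1 := ha.2 hx
        have h2 := hb.2 hy
        simp only [Set.mem_singleton_iff] at *
        linarith
    _ ≤ volume (A + B) := by
        apply measure_mono
        rintro _ (⟨x, hx, rfl⟩ | ⟨y, hy, rfl⟩)
        · exact Set.add_mem_add hx hb.1
        · exact Set.add_mem_add ha.1 hy

theorem volume_add_volume_le_two_mul_volume_of_midpointSet_subset {A B C : Set ℝ}
    (hA : MeasurableSet A) (hB : MeasurableSet B) (hA' : A.Nonempty) (hB' : B.Nonempty)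
    (hC : midpointSet A B ⊆ C) :
    volume A + volume B ≤ 2 * volume C := by
  have key : ∀ A' ⊆ A, ∀ B' ⊆ B, IsCompact A' → IsCompact B' →
      volume A' + volume B' ≤ 2 * volume C := by
    intro A' hAA B' hBB hA'c hB'c
    obtain ⟨a, ha⟩ := hA'
    obtain ⟨b, hb⟩ := hB'
    calc volume A' + volume B' ≤ volume (insert a A') + volume (insert b B') := by
          gcongr <;> exact Set.subset_insert _ _
      _ ≤ 2 * volume (midpointSet (insert a A') (insert b B')) :=
          volume_add_volume_le_two_mul_volume_midpointSet_of_isCompact (hA'c.insert a)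
            (hB'c.insert b) (Set.insert_nonempty _ _) (Set.insert_nonempty _ _)
      _ ≤ 2 * volume C := by
          gcongr
          refine Set.Subset.trans (Set.image_mono (Set.prod_mono ?_ ?_)) hC
          · exact Set.insert_subset ha hAA
          · exact Set.insert_subset hb hBB
  rw [hA.measure_eq_iSup_isCompact, hB.measure_eq_iSup_isCompact]
  simp_rw [iSup_and']
  exact ENNReal.biSup_add_biSup_le' ⟨∅, by simp⟩ ⟨∅, by simp⟩
    fun A' hA' B' hB' => key A' hA'.1 B' hB'.1 hA'.2 hB'.2

theorem ENNReal.mul_le_sq_of_add_le_two_mul {a b c : ℝ≥0∞} (h : a + b ≤ 2 * c) :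
    a * b ≤ c ^ 2 := by
  rcases eq_or_ne c ∞ with rfl | hc
  · simp
  have hab : a + b ≠ ∞ := ne_top_of_le_ne_top (by finiteness) h
  lift c to NNReal using hc
  lift a to NNReal using fun h => hab (by simp [h])
  lift b to NNReal using fun h => hab (by simp [h])
  norm_cast at h ⊢
  rw [← NNReal.coe_le_coe] at h ⊢
  push_cast at h ⊢
  nlinarith [sq_nonneg ((a : ℝ) - b), a.2, b.2, c.2]

theorem lintegral_mul_lintegral_le_of_sup_eq_one {f g h : ℝ → ℝ}
    (hf : Measurable f) (hg : Measurable g) (hh : Measurable h)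
    (hf0 : ∀ x, 0 ≤ f x) (hg0 : ∀ x, 0 ≤ g x) (hh0 : ∀ x, 0 ≤ h x)
    (hf1 : IsLUB (Set.range f) 1) (hg1 : IsLUB (Set.range g) 1)
    (hfgh : ∀ x y, f x * g y ≤ h (2⁻¹ * (x + y)) ^ 2) :
    (∫⁻ x, ENNReal.ofReal (f x)) * (∫⁻ x, ENNReal.ofReal (g x)) ≤
      (∫⁻ x, ENNReal.ofReal (h x)) ^ 2 := by
  apply ENNReal.mul_le_sq_of_add_le_two_mul
  have lc : ∀ φ : ℝ → ℝ, Measurable φ → (∀ x, 0 ≤ φ x) →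
      ∫⁻ x, ENNReal.ofReal (φ x) = ∫⁻ u in Set.Ioi 0, volume {x | u < φ x} :=
    fun φ hφ h0 => lintegral_eq_lintegral_meas_lt _ (Filter.Eventually.of_forall h0) hφ.aemeasurable
  rw [lc f hf hf0, lc g hg hg0, lc h hh hh0, ← lintegral_const_mul' _ _ (by simp),
    ← lintegral_add_left (f := fun u => volume {x | u < f x}) (Antitone.measurable
      fun u v huv => measure_mono fun x (hx : v < f x) => huv.trans_lt hx)]
  refine setLIntegral_mono' measurableSet_Ioi fun u hu => ?_
  rw [Set.mem_Ioi] at hu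
  by_cases hu1 : u < 1
  · apply volume_add_volume_le_two_mul_volume_of_midpointSet_subset
    · exact measurableSet_lt measurable_const hf
    · exact measurableSet_lt measurable_const hg
    · obtain ⟨_, ⟨x, rfl⟩, hx⟩ := (lt_isLUB_iff hf1).1 hu1
      exact ⟨x, hx⟩
    · obtain ⟨_, ⟨x, rfl⟩, hx⟩ := (lt_isLUB_iff hg1).1 hu1
      exact ⟨x, hx⟩
    · rintro _ ⟨⟨x, y⟩, ⟨hx, hy⟩, rfl⟩
      simp only [Set.mem_ofPred_eq, smul_eq_mul] at *
      exact lt_of_pow_lt_pow_left₀ 2 (hh0 _) ((by nlinarith : u ^ 2 < f x * g y).trans_le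
        (hfgh x y))
  · have e : ∀ φ : ℝ → ℝ, IsLUB (Set.range φ) 1 → {x | u < φ x} = ∅ := fun φ hφ =>
      Set.eq_empty_of_forall_notMem fun x (hx : u < φ x) =>
        hu1 (hx.trans_le (hφ.1 ⟨x, rfl⟩))
    simp [e f hf1, e g hg1]

/-- A midpoint form of the one-dimensional Prékopa–Leindler inequality, for bounded functions. -/
theorem lintegral_mul_lintegral_le_lintegral_sq {f g h : ℝ → ℝ}
    (hf : Measurable f) (hg : Measurable g) (hh : Measurable h)
    (hf0 : ∀ x, 0 ≤ f x) (hg0 : ∀ x, 0 ≤ g x) (hh0 : ∀ x, 0 ≤ h x)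
    (hfb : BddAbove (Set.range f)) (hgb : BddAbove (Set.range g))
    (hfgh : ∀ x y, f x * g y ≤ h (2⁻¹ * (x + y)) ^ 2) :
    (∫⁻ x, ENNReal.ofReal (f x)) * (∫⁻ x, ENNReal.ofReal (g x)) ≤
      (∫⁻ x, ENNReal.ofReal (h x)) ^ 2 := by
  set a := sSup (Set.range f) with ha
  set b := sSup (Set.range g) with hb
  have hfa : IsLUB (Set.range f) a := isLUB_csSup (Set.range_nonempty f) hfb
  have hgb : IsLUB (Set.range g) b := isLUB_csSup (Set.range_nonempty g) hgb
  have ha0 : 0 ≤ a := (hf0 0).trans (hfa.1 ⟨0, rfl⟩)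
  have hb0 : 0 ≤ b := (hg0 0).trans (hgb.1 ⟨0, rfl⟩)
  rcases ha0.eq_or_lt with ha0 | ha0
  · have : ∀ x, f x = 0 := fun x => le_antisymm (ha0 ▸ hfa.1 ⟨x, rfl⟩) (hf0 x)
    simp [this]
  rcases hb0.eq_or_lt with hb0 | hb0
  · have : ∀ x, g x = 0 := fun x => le_antisymm (hb0 ▸ hgb.1 ⟨x, rfl⟩) (hg0 x)
    simp [this]
  have hlub : ∀ (φ : ℝ → ℝ) (c : ℝ), 0 < c → IsLUB (Set.range φ) c →
      IsLUB (Set.range fun x => c⁻¹ * φ x) 1 := by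
    intro φ c hc hφ
    have := hφ.mul_left (inv_nonneg.2 hc.le)
    rw [inv_mul_cancel₀ hc.ne', ← Set.range_comp] at this
    exact this
  have hsq : 0 < √(a * b) := Real.sqrt_pos.2 (mul_pos ha0 hb0)
  have key := lintegral_mul_lintegral_le_of_sup_eq_one (f := fun x => a⁻¹ * f x)
    (g := fun x => b⁻¹ * g x) (h := fun x => (√(a * b))⁻¹ * h x)
    (by fun_prop) (by fun_prop) (by fun_prop)
    (fun x => mul_nonneg (by positivity) (hf0 x)) (fun x => mul_nonneg (by positivity) (hg0 x))
    (fun x => mul_nonneg (by positivity) (hh0 x)) (hlub f a ha0 hfa) (hlub g b hb0 hgb)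
    (fun x y => by
      rw [mul_pow, inv_pow, Real.sq_sqrt (by positivity), mul_inv, mul_mul_mul_comm]
      exact mul_le_mul_of_nonneg_left (hfgh x y) (by positivity))
  have hm : ∀ (c : ℝ) (φ : ℝ → ℝ), 0 < c → ∫⁻ x, ENNReal.ofReal (φ x) =
      ENNReal.ofReal c * ∫⁻ x, ENNReal.ofReal (c⁻¹ * φ x) := by
    intro c φ hc
    rw [← lintegral_const_mul' _ _ ENNReal.ofReal_ne_top]
    simp_rw [← ENNReal.ofReal_mul hc.le, mul_inv_cancel_left₀ hc.ne']
  rw [hm a f ha0, hm b g hb0, hm _ h hsq, mul_mul_mul_comm, mul_pow,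
    ← ENNReal.ofReal_mul ha0.le, ← ENNReal.ofReal_pow hsq.le, Real.sq_sqrt (by positivity)]
  gcongr

theorem MidpointBrunnMinkowski.real_prod {E : Type*} [AddCommGroup E] [Module ℝ E]
    [TopologicalSpace E] [MeasurableSpace E] [IsTopologicalAddGroup E] [ContinuousConstSMul ℝ E]
    [T2Space E] [SecondCountableTopology E] [BorelSpace E] {ν : Measure E} [SFinite ν]
    [IsFiniteMeasureOnCompacts ν] (hν : MidpointBrunnMinkowski ν) :
    MidpointBrunnMinkowski ((volume : Measure ℝ).prod ν) := by
  intro A B hA hB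
  have hC := hA.midpointSet hB
  have hsec : ∀ {S : Set (ℝ × E)}, IsCompact S → ∀ x : ℝ, IsCompact (Prod.mk x ⁻¹' S) :=
    fun hS x => (hS.image continuous_snd).of_isClosed_subset
      (hS.isClosed.preimage (by fun_prop)) fun y hy => ⟨(x, y), hy, rfl⟩
  have hlin : ∀ {S : Set (ℝ × E)}, IsCompact S → (volume : Measure ℝ).prod ν S =
      ∫⁻ x, ENNReal.ofReal (ν.real (Prod.mk x ⁻¹' S)) := fun hS => by
    rw [Measure.prod_apply hS.measurableSet]
    exact lintegral_congr fun x => (ofReal_measureReal (hsec hS x).measure_lt_top.ne).symm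
  have hmeas : ∀ {S : Set (ℝ × E)}, IsCompact S →
      Measurable fun x : ℝ => ν.real (Prod.mk x ⁻¹' S) := fun hS =>
    (measurable_measure_prodMk_left hS.measurableSet).ennreal_toReal
  have hbdd : ∀ {S : Set (ℝ × E)}, IsCompact S →
      BddAbove (Set.range fun x : ℝ => ν.real (Prod.mk x ⁻¹' S)) := by
    rintro S hS
    refine ⟨ν.real (Prod.snd '' S), ?_⟩
    rintro _ ⟨x, rfl⟩
    exact measureReal_mono (fun y hy => ⟨(x, y), hy, rfl⟩)
      (hS.image continuous_snd).measure_lt_top.ne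
  rw [hlin hA, hlin hB, hlin hC]
  refine lintegral_mul_lintegral_le_lintegral_sq (hmeas hA) (hmeas hB) (hmeas hC)
    (fun _ => measureReal_nonneg) (fun _ => measureReal_nonneg) (fun _ => measureReal_nonneg)
    (hbdd hA) (hbdd hB) fun x y => ?_
  have h1 := hν _ _ (hsec hA x) (hsec hB y)
  have h2 : midpointSet (Prod.mk x ⁻¹' A) (Prod.mk y ⁻¹' B) ⊆
      Prod.mk (2⁻¹ * (x + y)) ⁻¹' midpointSet A B := by
    rintro _ ⟨⟨u, v⟩, ⟨hu, hv⟩, rfl⟩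
    exact smul_add_mem_midpointSet (x := (x, u)) (y := (y, v)) hu hv
  have h3 := h1.trans (pow_le_pow_left' (measure_mono h2) 2)
  have := ENNReal.toReal_mono (ENNReal.pow_ne_top (hsec hC _).measure_lt_top.ne) h3
  rwa [ENNReal.toReal_mul, ENNReal.toReal_pow] at this

theorem midpointBrunnMinkowski_volume_pi :
    ∀ n : ℕ, MidpointBrunnMinkowski (volume : Measure (Fin n → ℝ))
  | 0 => by
    intro A B _ _
    rcases A.eq_empty_or_nonempty with rfl | ⟨a, ha⟩
    · simp
    rcases B.eq_empty_or_nonempty with rfl | ⟨b, hb⟩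
    · simp
    rw [Subsingleton.eq_univ_of_nonempty ⟨a, ha⟩, Subsingleton.eq_univ_of_nonempty ⟨b, hb⟩,
      Subsingleton.eq_univ_of_nonempty ⟨_, smul_add_mem_midpointSet (Set.mem_univ a)
        (Set.mem_univ b)⟩, sq]
  | n + 1 => by
    let L : (Fin (n + 1) → ℝ) →ₗ[ℝ] ℝ × (Fin n → ℝ) :=
      (LinearMap.proj 0).prod (LinearMap.funLeft ℝ ℝ Fin.succ)
    refine (midpointBrunnMinkowski_volume_pi n).real_prod.of_measurePreserving L
      L.continuous_of_finiteDimensional ?_ ?_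
    · intro x y hxy
      exact (MeasurableEquiv.piFinSuccAbove (fun _ => ℝ) 0).injective hxy
    · exact volume_preserving_piFinSuccAbove (fun _ => ℝ) 0

theorem midpointBrunnMinkowski_volume_euclideanSpace (n : ℕ) :
    MidpointBrunnMinkowski (volume : Measure (EuclideanSpace ℝ (Fin n))) :=
  (midpointBrunnMinkowski_volume_pi n).of_measurePreserving
    (WithLp.linearEquiv 2 ℝ (Fin n → ℝ)).toLinearMap
    (LinearMap.continuous_of_finiteDimensional _) (WithLp.linearEquiv 2 ℝ (Fin n → ℝ)).injective
    (PiLp.volume_preserving_ofLp (Fin n))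

theorem IsSymmConvexBody.mem_nhds_zero {E : Type*} [NormedAddCommGroup E] [NormedSpace ℝ E]
    {K : Set E} (hK : IsSymmConvexBody K) : K ∈ nhds 0 := by
  obtain ⟨-, hconv, ⟨x, hx⟩, hsymm⟩ := hK
  have hx' : -x ∈ interior K := by
    rw [hsymm]
    exact ((Homeomorph.neg E).preimage_interior K).le (by simpa using hx)
  have := hconv.interior.midpoint_mem hx hx'
  rw [midpoint_self_neg] at this
  exact mem_interior_iff_mem_nhds.1 this

theorem IsSymmConvexBody.mem_smul_of_gauge_le {E : Type*} [NormedAddCommGroup E]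
    [NormedSpace ℝ E] {K : Set E} (hK : IsSymmConvexBody K) {x : E} {r : ℝ} (hr : 0 < r)
    (hx : gauge K x ≤ r) : x ∈ r • K := by
  rw [Set.mem_smul_set_iff_inv_smul_mem₀ hr.ne', ← hK.1.isClosed.closure_eq,
    ← gauge_le_one_iff_mem_closure hK.2.1 hK.mem_nhds_zero,
    gauge_smul_of_nonneg (inv_nonneg.2 hr.le), smul_eq_mul]
  exact inv_mul_le_one_of_le₀ hx hr.le

theorem IsSymmConvexBody.norm_div_le_gauge {E : Type*} [NormedAddCommGroup E]
    [NormedSpace ℝ E] {K : Set E} (hK : IsSymmConvexBody K) (x : E) :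
    ‖x‖ / (Metric.diam K / 2) ≤ gauge K x := by
  refine le_gauge_of_subset_closedBall (absorbent_nhds_zero hK.mem_nhds_zero)
    (by positivity) fun y hy => ?_
  have hy' : -y ∈ K := by
    rw [hK.2.2.2]
    simpa using hy
  have := Metric.dist_le_diam_of_mem hK.1.isBounded hy hy'
  rw [dist_eq_norm, sub_neg_eq_add, ← two_smul ℝ, norm_smul, Real.norm_two] at this
  rw [mem_closedBall_zero_iff]
  linarith

theorem IsPConvex.gauge_midpoint_le {E : Type*} [AddCommGroup E] [Module ℝ E] {K : Set E}
    {p α : ℝ} (hpc : IsPConvex K p α) (hK : Convex ℝ K) (hK0 : Absorbent ℝ K) {ε : ℝ}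
    (hε : 0 < ε) (hε2 : ε ≤ 2) {x y : E} (hx : gauge K x ≤ 1) (hy : gauge K y ≤ 1)
    (hxy : ε ≤ gauge K (x - y)) :
    gauge K ((2⁻¹ : ℝ) • (x + y)) ≤ 1 - α * ε ^ p := by
  have hbdd : BddBelow { d | ∃ x y : E, gauge K x ≤ 1 ∧ gauge K y ≤ 1 ∧ ε ≤ gauge K (x - y) ∧
      d = 1 - gauge K ((2:ℝ)⁻¹ • (x + y)) } := by
    refine ⟨0, ?_⟩
    rintro _ ⟨u, v, hu, hv, -, rfl⟩
    have := gauge_add_le hK hK0 u v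
    rw [gauge_smul_of_nonneg (by norm_num), smul_eq_mul]
    linarith
  have := (hpc ε hε hε2).trans (csInf_le hbdd ⟨x, y, hx, hy, hxy, rfl⟩)
  linarith

/-- Two subsets of a `p`-convex body which are far apart cannot both have large volume. -/
theorem IsPConvex.volume_mul_volume_le {n : ℕ} {K : Set (EuclideanSpace ℝ (Fin n))} {p α : ℝ}
    (hpc : IsPConvex K p α) (hK : IsSymmConvexBody K) (hvol : volume K = 1) {ε : ℝ}
    (hε : 0 < ε) (hε2 : ε ≤ 2) {A B : Set (EuclideanSpace ℝ (Fin n))} (hA : IsCompact A)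
    (hB : IsCompact B) (hAK : A ⊆ K) (hBK : B ⊆ K)
    (hAB : ∀ x ∈ A, ∀ y ∈ B, ε ≤ gauge K (x - y)) :
    volume A * volume B ≤ ENNReal.ofReal (Real.exp (-2 * α * n * ε ^ p)) := by
  have hsub : midpointSet A B ⊆ Real.exp (-(α * ε ^ p)) • K := by
    rintro _ ⟨⟨x, y⟩, ⟨hx, hy⟩, rfl⟩
    refine hK.mem_smul_of_gauge_le (Real.exp_pos _) ?_
    exact (hpc.gauge_midpoint_le hK.2.1 (absorbent_nhds_zero hK.mem_nhds_zero) hε hε2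
      (gauge_le_one_of_mem (hAK hx)) (gauge_le_one_of_mem (hBK hy)) (hAB x hx y hy)).trans
      (Real.one_sub_le_exp_neg _)
  calc volume A * volume B ≤ volume (midpointSet A B) ^ 2 :=
        midpointBrunnMinkowski_volume_euclideanSpace n A B hA hB
    _ ≤ volume (Real.exp (-(α * ε ^ p)) • K) ^ 2 := by gcongr
    _ = ENNReal.ofReal (Real.exp (-2 * α * n * ε ^ p)) := by
        rw [Measure.addHaar_smul_of_nonneg _ (Real.exp_pos _).le, hvol, mul_one,
          finrank_euclideanSpace_fin, ← ENNReal.ofReal_pow (by positivity), ← Real.exp_nat_mul,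
          ← Real.exp_nat_mul]
        congr 2
        push_cast
        ring

end BrunnMinkowski

theorem pConvex_concentration_median {n : ℕ} (K : Set (EuclideanSpace ℝ (Fin n)))
    (p α : ℝ) (hp : 1 ≤ p) (hK : IsSymmConvexBody K) (hvol : volume K = 1)
    (hα : 0 < α) (hpc : IsPConvex K p α)
    (f : EuclideanSpace ℝ (Fin n) → ℝ) (hf : LipschitzWith 1 f)
    (M : ℝ)
    (hM₁ : (1 : ℝ≥0∞) / 2 ≤ volume {x | x ∈ K ∧ M ≤ f x})
    (hM₂ : (1 : ℝ≥0∞) / 2 ≤ volume {x | x ∈ K ∧ f x ≤ M})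
    (t : ℝ) (ht : 0 < t) :
    volume {x | x ∈ K ∧ M + t ≤ f x} ≤
      ENNReal.ofReal (2 * Real.exp (-2 * α * n * (t / Metric.diam K) ^ p)) := by
  set A := {x | x ∈ K ∧ f x ≤ M}
  set B := {x | x ∈ K ∧ M + t ≤ f x}
  have hAc : IsCompact A := hK.1.inter_right (isClosed_le hf.continuous continuous_const)
  have hBc : IsCompact B := hK.1.inter_right (isClosed_le continuous_const hf.continuous)
  rcases B.eq_empty_or_nonempty with hBe | ⟨b, hb⟩
  · simp [hBe]
  have hAne : A.Nonempty := by
    rw [Set.nonempty_iff_ne_empty]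
    intro hAe
    simp [hAe] at hM₂
  obtain ⟨a, ha⟩ := hAne
  have hdist : ∀ x ∈ A, ∀ y ∈ B, t ≤ ‖x - y‖ := by
    intro x hx y hy
    have h := hf.dist_le_mul y x
    rw [NNReal.coe_one, one_mul, Real.dist_eq, dist_eq_norm, norm_sub_rev] at h
    linarith [le_abs_self (f y - f x), hx.2, hy.2]
  have htd : t ≤ Metric.diam K := (hdist a ha b hb).trans
    (dist_eq_norm a b ▸ Metric.dist_le_diam_of_mem hK.1.isBounded ha.1 hb.1)
  have hd : 0 < Metric.diam K := ht.trans_le htd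
  have hε : 0 < t / (Metric.diam K / 2) := by positivity
  have hε2 : t / (Metric.diam K / 2) ≤ 2 := by
    rw [div_le_iff₀ (by positivity)]
    linarith
  have hmul := hpc.volume_mul_volume_le hK hvol hε hε2 hAc hBc (fun _ h => h.1) (fun _ h => h.1)
    fun x hx y hy => le_trans (by gcongr; exact hdist x hx y hy) (hK.norm_div_le_gauge (x - y))
  have hexp : Real.exp (-2 * α * n * (t / (Metric.diam K / 2)) ^ p) ≤
      Real.exp (-2 * α * n * (t / Metric.diam K) ^ p) := by
    have : (t / Metric.diam K) ^ p ≤ (t / (Metric.diam K / 2)) ^ p :=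
      Real.rpow_le_rpow (by positivity) (by gcongr; linarith) (by linarith)
    have := mul_le_mul_of_nonneg_left this (by positivity : 0 ≤ 2 * α * n)
    exact Real.exp_le_exp.2 (by linarith)
  calc volume B = 2 * (1 / 2 * volume B) := by
        rw [← mul_assoc, one_div, ENNReal.mul_inv_cancel two_ne_zero ENNReal.ofNat_ne_top, one_mul]
    _ ≤ 2 * (volume A * volume B) := by gcongr
    _ ≤ 2 * ENNReal.ofReal (Real.exp (-2 * α * n * (t / Metric.diam K) ^ p)) := by
        gcongr
        exact hmul.trans (ENNReal.ofReal_le_ofReal hexp)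
    _ = _ := by rw [ENNReal.ofReal_mul zero_le_two, ENNReal.ofReal_ofNat]
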